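/- Let Ω be a locally compact Hausdorff topological space and let C₀(Ω) be the Banach space of real-valued continuous functions on Ω vanishing at infinity, with the supremum norm. If the norm of C₀(Ω) is strongly subdifferentiable at every unit vector, then every point of Ω is an isolated point, i.e., Ω is discrete. -/

import Mathlib

open NormedSpace Filter Metric Topology
open scoped ZeroAtInfty

/-- The norm of `X` is strongly subdifferentiable (SSD) at `x`: the one-sided limit
`lim_{t→0⁺} (‖x+ty‖−‖x‖)/t` exists uniformly for `y` in the closed unit ball. -/
def StronglySubdifferentiableAt (X : Type*) [NormedAddCommGroup X] [NormedSpace ℝ X]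
    (x : X) : Prop :=
  ∃ φ : X → ℝ, ∀ ε > 0, ∃ δ > 0, ∀ t : ℝ, 0 < t → t < δ →
    ∀ y : X, ‖y‖ ≤ 1 → |(‖x + t • y‖ - ‖x‖) / t - φ y| < ε

namespace ZeroAtInftyContinuousMap

section Norm

variable {X : Type*} [TopologicalSpace X]

theorem abs_apply_le_norm (f : C₀(X, ℝ)) (x : X) : |f x| ≤ ‖f‖ :=
  f.toBCF.norm_coe_le_norm x

theorem norm_le_of_forall_abs_le (f : C₀(X, ℝ)) {C : ℝ} (hC : 0 ≤ C) (hf : ∀ x, |f x| ≤ C) :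
    ‖f‖ ≤ C :=
  (BoundedContinuousFunction.norm_le (f := f.toBCF) hC).2 hf

/-- A function with values in `[0, 1]` that attains the value `1` has norm `1`. -/
theorem norm_eq_one_of_apply_eq_one {f : C₀(X, ℝ)} (h0 : ∀ x, 0 ≤ f x) (h1 : ∀ x, f x ≤ 1)
    {p : X} (hp : f p = 1) : ‖f‖ = 1 := by
  refine le_antisymm (f.norm_le_of_forall_abs_le zero_le_one fun x => ?_) ?_
  · rw [abs_of_nonneg (h0 x)]
    exact h1 x
  · simpa [hp] using f.abs_apply_le_norm p

/-- Postcomposition with a continuous function fixing `0`. -/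
def postcomp (F : C(ℝ, ℝ)) (hF : F 0 = 0) (f : C₀(X, ℝ)) : C₀(X, ℝ) where
  toFun x := F (f x)
  continuous_toFun := F.continuous.comp (map_continuous f)
  zero_at_infty' := by
    have h := (F.continuous.tendsto 0).comp (zero_at_infty f)
    rwa [hF] at h

/-- A continuous function with compact support, as a function vanishing at infinity. -/
def ofHasCompactSupport (f : C(X, ℝ)) (hf : HasCompactSupport f) : C₀(X, ℝ) where
  toContinuousMap := f
  zero_at_infty' := hf.is_zero_at_infty

/-- Evaluation at a point as a continuous linear functional. -/
noncomputable def evalCLM (x : X) : C₀(X, ℝ) →L[ℝ] ℝ :=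
  LinearMap.mkContinuous
    { toFun := fun f => f x
      map_add' := fun _ _ => rfl
      map_smul' := fun _ _ => rfl } 1 fun f => by
    simpa using f.abs_apply_le_norm x

theorem evalCLM_apply (x : X) (f : C₀(X, ℝ)) : evalCLM x f = f x :=
  rfl

/-- At a point of strong subdifferentiability, a peak function has no values slightly below its
peak value. -/
theorem exists_forall_eq_one_of_stronglySubdifferentiableAt {g : C₀(X, ℝ)}
    (hg : StronglySubdifferentiableAt C₀(X, ℝ) g) (h0 : ∀ x, 0 ≤ g x) (h1 : ∀ x, g x ≤ 1)
    {p : X} (hp : g p = 1) : ∃ η > 0, ∀ x, 1 - η < g x → g x = 1 := by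
  obtain ⟨φ, hφ⟩ := hg
  obtain ⟨δ, hδ, H⟩ := hφ (1 / 8) (by norm_num)
  refine ⟨min (δ / 2) (1 / 4), by positivity, fun x hx => ?_⟩
  by_contra hne
  have hlt : g x < 1 := lt_of_le_of_ne (h1 x) hne
  obtain ⟨s, hs⟩ : ∃ s, s = 1 - g x := ⟨_, rfl⟩
  have hs0 : 0 < s := by linarith
  have hsδ : s < δ / 2 := by linarith [min_le_left (δ / 2) (1 / 4 : ℝ)]
  have hs4 : s < 1 / 4 := by linarith [min_le_right (δ / 2) (1 / 4 : ℝ)]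
  let F : C(ℝ, ℝ) := ⟨fun u => min u ((1 - u) / s), by fun_prop⟩
  have hF : F 0 = 0 := by
    change min (0 : ℝ) ((1 - 0) / s) = 0
    exact min_eq_left (by positivity)
  let y : C₀(X, ℝ) := g.postcomp F hF
  have hy (z : X) : y z = min (g z) ((1 - g z) / s) := rfl
  have hy0 (z : X) : 0 ≤ y z := by
    rw [hy]
    exact le_min (h0 z) (div_nonneg (by linarith [h1 z]) hs0.le)
  have hy1 (z : X) : y z ≤ 1 := (min_le_left _ _).trans (h1 z)
  have hys (z : X) : s * y z ≤ 1 - g z := by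
    have h := (le_div_iff₀ hs0).1 (min_le_right (g z) ((1 - g z) / s))
    rw [hy]
    linarith
  have hyn : ‖y‖ ≤ 1 := y.norm_le_of_forall_abs_le zero_le_one fun z => by
    rw [abs_of_nonneg (hy0 z)]
    exact hy1 z
  have hgn : ‖g‖ = 1 := norm_eq_one_of_apply_eq_one h0 h1 hp
  have happ (t : ℝ) (z : X) : (g + t • y) z = g z + t * y z := rfl
  have hgs : ‖g + s • y‖ = 1 := by
    refine norm_eq_one_of_apply_eq_one (p := p) (fun z => ?_) (fun z => ?_) ?_
    · rw [happ]
      have := h0 z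
      have := hy0 z
      positivity
    · rw [happ]
      linarith [hys z]
    · have := hys p
      have := mul_nonneg hs0.le (hy0 p)
      rw [happ]
      linarith
  have hyx : y x = 1 - s := by
    rw [hy, ← hs, div_self hs0.ne', min_eq_left (h1 x)]
    linarith
  have hg2s : 1 - s + 2 * s * (1 - s) ≤ ‖g + (2 * s) • y‖ := by
    have h := (le_abs_self _).trans ((g + (2 * s) • y).abs_apply_le_norm x)
    rw [happ, hyx] at h
    linarith
  have A := H s hs0 (by linarith) y hyn
  have B := H (2 * s) (by linarith) (by linarith) y hyn
  rw [hgs, hgn, sub_self, zero_div, abs_lt] at A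
  rw [hgn, abs_lt] at B
  have C : 1 / 4 ≤ (‖g + (2 * s) • y‖ - 1) / (2 * s) := by
    rw [le_div_iff₀ (by linarith)]
    nlinarith
  linarith [A.1, B.2]

end Norm

section LocallyCompact

variable {X : Type*} [TopologicalSpace X] [LocallyCompactSpace X] [T2Space X]

/-- If the norm of `C₀(X)` is strongly subdifferentiable on the unit sphere, then every function
in `C₀(X)` is locally constant. -/
theorem eventually_eq_of_stronglySubdifferentiableAt
    (h : ∀ f : C₀(X, ℝ), ‖f‖ = 1 → StronglySubdifferentiableAt C₀(X, ℝ) f)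
    (f : C₀(X, ℝ)) (p : X) : ∀ᶠ x in 𝓝 p, f x = f p := by
  obtain ⟨c, hc1, -, hcs, hc01⟩ := exists_continuous_one_zero_of_isCompact
    (isCompact_singleton (x := p)) isClosed_empty (Set.disjoint_empty _)
  have hcp : c p = 1 := hc1 rfl
  let b : C(X, ℝ) :=
    ⟨fun x => max 0 (1 - |f x - f p|), by have := map_continuous f; fun_prop⟩
  let g : C₀(X, ℝ) := ofHasCompactSupport (c * b) hcs.mul_right
  have hg (x : X) : g x = c x * max 0 (1 - |f x - f p|) := rfl
  have hb0 (x : X) : 0 ≤ max 0 (1 - |f x - f p|) := le_max_left _ _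
  have hb1 (x : X) : max 0 (1 - |f x - f p|) ≤ 1 :=
    max_le zero_le_one (by linarith [abs_nonneg (f x - f p)])
  have h0 (x : X) : 0 ≤ g x := mul_nonneg (hc01 x).1 (hb0 x)
  have h1 (x : X) : g x ≤ 1 := mul_le_one₀ (hc01 x).2 (hb0 x) (hb1 x)
  have hp : g p = 1 := by simp [hg, hcp]
  obtain ⟨η, hη, H⟩ := exists_forall_eq_one_of_stronglySubdifferentiableAt
    (h g (norm_eq_one_of_apply_eq_one h0 h1 hp)) h0 h1 hp
  have hlt : 1 - η < g p := by linarith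
  filter_upwards [(map_continuous g).continuousAt.eventually (lt_mem_nhds hlt)] with x hx
  have hle : 1 ≤ max 0 (1 - |f x - f p|) := by
    have hle : g x ≤ max 0 (1 - |f x - f p|) := mul_le_of_le_one_left (hb0 x) (hc01 x).2
    rwa [H x hx] at hle
  have habs : |f x - f p| ≤ 0 := by
    rcases le_max_iff.1 hle with h | h <;> linarith
  exact sub_eq_zero.1 (abs_nonpos_iff.1 habs)

/-- In an infinite open set there is a sequence of points separated by a single function
vanishing at infinity. -/
theorem exists_seq_mem_injective_apply {V : Set X} (hV : IsOpen V) (hinf : V.Infinite) :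
    ∃ (x : ℕ → X) (f : C₀(X, ℝ)), (∀ n, x n ∈ V) ∧ Function.Injective fun n => f (x n) := by
  have : Infinite V := hinf.to_subtype
  obtain ⟨U, hUi, hUo, hUd⟩ := exists_seq_infinite_isOpen_pairwise_disjoint V
  choose x hx using fun n => (hUi n).nonempty
  have hWo (n : ℕ) : IsOpen (Subtype.val '' U n) := hV.isOpenMap_subtype_val _ (hUo n)
  have hxW (n : ℕ) : (x n : X) ∈ Subtype.val '' U n := ⟨x n, hx n, rfl⟩
  have hbump (n : ℕ) := exists_continuous_one_zero_of_isCompact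
    (isCompact_singleton (x := (x n : X))) (hWo n).isClosed_compl
    (Set.disjoint_singleton_left.2 fun h => h (hxW n))
  choose g hg1 hg0 hgs hg01 using hbump
  let G (n : ℕ) : C₀(X, ℝ) := ((1 / 2 : ℝ) ^ n) • ofHasCompactSupport (g n) (hgs n)
  have hG (n : ℕ) (z : X) : G n z = (1 / 2 : ℝ) ^ n * g n z := rfl
  have hGn (n : ℕ) : ‖G n‖ ≤ (1 / 2 : ℝ) ^ n :=
    (G n).norm_le_of_forall_abs_le (by positivity) fun z => by
      rw [hG, abs_of_nonneg (mul_nonneg (by positivity) (hg01 n z).1)]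
      exact mul_le_of_le_one_right (by positivity) (hg01 n z).2
  have hsum : Summable G := Summable.of_norm_bounded summable_geometric_two hGn
  have hval (n : ℕ) : (∑' m, G m) (x n : X) = (1 / 2 : ℝ) ^ n := by
    have hs : HasSum (fun m => G m (x n : X)) ((∑' m, G m) (x n : X)) := by
      simpa only [evalCLM_apply] using (evalCLM (x n : X)).hasSum hsum.hasSum
    have hne (m : ℕ) (hmn : m ≠ n) : G m (x n : X) = 0 := by
      have hmem : (x n : X) ∈ (Subtype.val '' U m)ᶜ := by
        rintro ⟨z, hz, hzx⟩
        rw [Subtype.val_injective hzx] at hz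
        exact (hUd hmn).le_bot ⟨hz, hx n⟩
      rw [hG, hg0 m hmem, Pi.zero_apply, mul_zero]
    rw [hs.unique (hasSum_single n hne), hG, hg1 n rfl, Pi.one_apply, mul_one]
  refine ⟨fun n => x n, ∑' m, G m, fun n => (x n).2, fun m n hmn => ?_⟩
  simp only [hval] at hmn
  exact pow_right_injective₀ (by norm_num) (by norm_num) hmn

end LocallyCompact

end ZeroAtInftyContinuousMap

open ZeroAtInftyContinuousMap in
/-- If the supremum norm of `C₀(Ω)` over a locally compact Hausdorff space `Ω` is strongly
subdifferentiable at every unit vector, then `Ω` is discrete. -/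
theorem stmt10 (Ω : Type*) [TopologicalSpace Ω] [LocallyCompactSpace Ω] [T2Space Ω]
    (h : ∀ f : C₀(Ω, ℝ), ‖f‖ = 1 → StronglySubdifferentiableAt C₀(Ω, ℝ) f) :
    DiscreteTopology Ω := by
  rw [discreteTopology_iff_isOpen_singleton]
  intro p
  obtain ⟨K, hK, hpK⟩ := exists_compact_mem_nhds p
  by_cases hfin : (interior K).Finite
  · have hsub : ((interior K) \ {p}).Finite := hfin.subset Set.sdiff_subset
    have hopen := isOpen_interior.sdiff hsub.isClosed (s := interior K)
    rwa [Set.sdiff_sdiff_cancel_left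
      (Set.singleton_subset_iff.2 (mem_interior_iff_mem_nhds.2 hpK))] at hopen
  · obtain ⟨x, f, hxV, hinj⟩ := exists_seq_mem_injective_apply isOpen_interior hfin
    obtain ⟨q, -, hq⟩ := hK.exists_mapClusterPt (u := x) (f := atTop)
      (tendsto_principal.2 (Eventually.of_forall fun n => interior_subset (hxV n)))
    have hfreq : ∃ᶠ n in atTop, f (x n) = f q :=
      hq.frequently (eventually_eq_of_stronglySubdifferentiableAt h f q)
    obtain ⟨m, -, hm⟩ := frequently_atTop.1 hfreq 0
    obtain ⟨n, hmn, hn⟩ := frequently_atTop.1 hfreq (m + 1)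
    have : m = n := hinj (hm.trans hn.symm)
    omega
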